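/- arXiv:2602.12447 — 3 statements merged into one kernel-verified Lean document; each statement's English description precedes it below -/
import Mathlib

section
/- For every M > 1, every nonempty σ* ∈ Ω* admits exactly one M-partition: there exists a unique partition of σ* into pairwise compatible M-contours. -/
open scoped Classical BigOperators ENNReal

noncomputable section

/-- The long-range coupling `J(x,y) = |x-y|^(-α)` for `x ≠ y`, `J(x,x) = 0`. -/
def J (α : ℝ) (x y : ℤ) : ℝ := if x = y then 0 else |(x : ℝ) - (y : ℝ)| ^ (-α)

lemma J_symm (α : ℝ) (x y : ℤ) : J α x y = J α y x := by
  unfold J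
  rcases eq_or_ne x y with h | h
  · simp [h]
  · rw [if_neg h, if_neg (Ne.symm h), abs_sub_comm]

/-- `H(A) = Σ_{x∈A, y∉A} 2 J(x,y)` for a set `A ⊆ ℤ`. -/
def HamSet (α : ℝ) (A : Set ℤ) : ℝ :=
  ∑' p : ℤ × ℤ, if p.1 ∈ A ∧ p.2 ∉ A then 2 * J α p.1 p.2 else 0

/-- `H(A)` for a finite set `A`. -/
def Ham (α : ℝ) (A : Finset ℤ) : ℝ := HamSet α ↑A

/-- `Φ(A,B) = Σ_{x∈A, y∈B} 4 J(x,y)`. -/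
def PhiSet (α : ℝ) (A B : Set ℤ) : ℝ :=
  ∑' p : ℤ × ℤ, if p.1 ∈ A ∧ p.2 ∈ B then 4 * J α p.1 p.2 else 0

lemma PhiSet_symm (α : ℝ) (A B : Set ℤ) : PhiSet α A B = PhiSet α B A := by
  unfold PhiSet
  rw [← (Equiv.prodComm ℤ ℤ).tsum_eq
    (fun p : ℤ × ℤ => if p.1 ∈ B ∧ p.2 ∈ A then 4 * J α p.1 p.2 else 0)]
  apply tsum_congr
  intro p
  by_cases h : p.1 ∈ A ∧ p.2 ∈ B
  · rw [if_pos h, Equiv.prodComm_apply]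
    simp only [Prod.fst_swap, Prod.snd_swap]
    rw [if_pos ⟨h.2, h.1⟩, J_symm]
  · rw [if_neg h, Equiv.prodComm_apply]
    simp only [Prod.fst_swap, Prod.snd_swap]
    rw [if_neg (by tauto)]

/-- distance between two finite sets of (dual) sites; junk value `0` if either is empty. -/
def fdist (γ₁ γ₂ : Finset ℤ) : ℝ :=
  if h : (γ₁ ×ˢ γ₂).Nonempty then
    ((γ₁ ×ˢ γ₂).image fun p => |(p.1 : ℝ) - (p.2 : ℝ)|).min' (h.image _)
  else 0

/-- diameter of a finite set of (dual) sites; junk value `0` if empty. -/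
def fdiam (γ : Finset ℤ) : ℝ :=
  if h : (γ ×ˢ γ).Nonempty then
    ((γ ×ˢ γ).image fun p => |(p.1 : ℝ) - (p.2 : ℝ)|).max' (h.image _)
  else 0

/-- Minus interior of a collection of spin flips.  We index the dual lattice
`ℤ* = ℤ + 1/2` by `ℤ`, the dual site `b : ℤ` standing for `b + 1/2`; a dual
site `b + 1/2` is larger than `x : ℤ` iff `x ≤ b`. -/
def minusI (γ : Finset ℤ) : Set ℤ := {x : ℤ | Odd (γ.filter fun b => x ≤ b).card}

/-- A partition of `γ` into nonempty parts of even cardinality. -/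
def IsEvenPartition (P : Finset (Finset ℤ)) (γ : Finset ℤ) : Prop :=
  (∀ p ∈ P, p.Nonempty ∧ Even p.card) ∧
  (P : Set (Finset ℤ)).PairwiseDisjoint id ∧ P.biUnion id = γ

/-- `γ` is an `M`-contour. -/
def IsContour (M : ℝ) (γ : Finset ℤ) : Prop :=
  γ.Nonempty ∧ Even γ.card ∧
  ∀ P : Finset (Finset ℤ), IsEvenPartition P γ → 2 ≤ P.card →
    ∃ γ₁ ∈ P, ∃ γ₂ ∈ P, γ₁ ≠ γ₂ ∧
      fdist γ₁ γ₂ ≤ M * min (fdiam γ₁) (fdiam γ₂) ^ ((3 : ℝ) / 2)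

/-- Compatibility of (distinct) contours. -/
def Compat (M : ℝ) (γ₁ γ₂ : Finset ℤ) : Prop :=
  γ₁ ≠ γ₂ ∧ M * min (fdiam γ₁) (fdiam γ₂) ^ ((3 : ℝ) / 2) < fdist γ₁ γ₂

/-- Positive compatibility of contours. -/
def PosCompat (M : ℝ) (γ₁ γ₂ : Finset ℤ) : Prop :=
  Compat M γ₁ γ₂ ∧ Disjoint (minusI γ₁) (minusI γ₂)

/-- `Γ` is an `M`-partition of `σ`. -/
def IsMPartitionOf (M : ℝ) (Γ : Finset (Finset ℤ)) (σ : Finset ℤ) : Prop :=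
  (∀ γ ∈ Γ, IsContour M γ) ∧ (Γ : Set (Finset ℤ)).PairwiseDisjoint id ∧
  Γ.biUnion id = σ ∧ ∀ γ₁ ∈ Γ, ∀ γ₂ ∈ Γ, γ₁ ≠ γ₂ → Compat M γ₁ γ₂

/-- `Γ` is an `M`-partition (of some nonempty `σ* ∈ Ω*`). -/
def IsMPartition (M : ℝ) (Γ : Finset (Finset ℤ)) : Prop :=
  Γ.Nonempty ∧ IsMPartitionOf M Γ (Γ.biUnion id)

/-- A polymer: an `M`-partition with pairwise positively compatible contours. -/
def IsPolymer (M : ℝ) (Γ : Finset (Finset ℤ)) : Prop :=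
  IsMPartition M Γ ∧ ∀ γ₁ ∈ Γ, ∀ γ₂ ∈ Γ, γ₁ ≠ γ₂ → PosCompat M γ₁ γ₂

/-- Minus interior of a collection `Γ` of contours. -/
def minusISet (Γ : Finset (Finset ℤ)) : Set ℤ := minusI (Γ.biUnion id)

/-- `H` of a single contour. -/
def Hcont (α : ℝ) (γ : Finset ℤ) : ℝ := HamSet α (minusI γ)

/-- `H` of a collection of contours. -/
def HamPart (α : ℝ) (Γ : Finset (Finset ℤ)) : ℝ := HamSet α (minusISet Γ)

/-- The external contours `∂Γ`. -/
def extC (Γ : Finset (Finset ℤ)) : Finset (Finset ℤ) :=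
  Γ.filter fun γ => ∀ γ' ∈ Γ, γ' ≠ γ →
    (minusI γ' ⊆ minusI γ ∨ Disjoint (minusI γ') (minusI γ))

/-- `ι_{γ₀}(Γ)`. -/
def iota (γ₀ : Finset ℤ) (Γ : Finset (Finset ℤ)) : Finset (Finset ℤ) :=
  insert γ₀ ((Γ.erase γ₀).filter fun γ => minusI γ ⊆ minusI γ₀)

/-- `ι*_{γ₀}(Γ)`. -/
def iotaStar (γ₀ : Finset ℤ) (Γ : Finset (Finset ℤ)) : Finset (Finset ℤ) :=
  (iota γ₀ Γ).erase γ₀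


lemma aux_fdist_le {A B : Finset ℤ} {a b : ℤ} (ha : a ∈ A) (hb : b ∈ B) :
    fdist A B ≤ |(a : ℝ) - b| := by
  have h : (A ×ˢ B).Nonempty := ⟨(a, b), by simp [ha, hb]⟩
  unfold fdist
  rw [dif_pos h]
  exact Finset.min'_le _ _ (Finset.mem_image.2 ⟨(a, b), by simp [ha, hb], rfl⟩)

lemma aux_fdist_eq {A B : Finset ℤ} (hA : A.Nonempty) (hB : B.Nonempty) :
    ∃ a ∈ A, ∃ b ∈ B, fdist A B = |(a : ℝ) - b| := by
  have h : (A ×ˢ B).Nonempty := hA.product hB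
  have := Finset.min'_mem _ (h.image fun p => |(p.1 : ℝ) - (p.2 : ℝ)|)
  obtain ⟨p, hp, he⟩ := Finset.mem_image.1 this
  rw [Finset.mem_product] at hp
  refine ⟨p.1, hp.1, p.2, hp.2, ?_⟩
  unfold fdist
  rw [dif_pos h]
  exact he.symm

lemma aux_le_fdiam {A : Finset ℤ} {a b : ℤ} (ha : a ∈ A) (hb : b ∈ A) :
    |(a : ℝ) - b| ≤ fdiam A := by
  have h : (A ×ˢ A).Nonempty := ⟨(a, b), by simp [ha, hb]⟩
  unfold fdiam
  rw [dif_pos h]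
  apply Finset.le_max'
  exact Finset.mem_image.2 ⟨(a, b), Finset.mem_product.2 ⟨ha, hb⟩, rfl⟩

lemma aux_fdiam_eq {A : Finset ℤ} (hA : A.Nonempty) :
    ∃ a ∈ A, ∃ b ∈ A, fdiam A = |(a : ℝ) - b| := by
  have h : (A ×ˢ A).Nonempty := hA.product hA
  have := Finset.max'_mem _ (h.image fun p => |(p.1 : ℝ) - (p.2 : ℝ)|)
  obtain ⟨p, hp, he⟩ := Finset.mem_image.1 this
  rw [Finset.mem_product] at hp
  refine ⟨p.1, hp.1, p.2, hp.2, ?_⟩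
  unfold fdiam
  rw [dif_pos h]
  exact he.symm

lemma aux_fdiam_nat {A : Finset ℤ} (hA : A.Nonempty) : ∃ n : ℕ, fdiam A = n := by
  obtain ⟨a, -, b, -, h⟩ := aux_fdiam_eq hA
  refine ⟨(a - b).natAbs, ?_⟩
  rw [h, Nat.cast_natAbs]
  push_cast
  rfl

lemma aux_one_le_fdiam {A : Finset ℤ} (hA : A.Nonempty) (he : Even A.card) : 1 ≤ fdiam A := by
  have h1 : 1 < A.card := by
    have := hA.card_pos
    obtain ⟨k, hk⟩ := he
    omega
  obtain ⟨a, ha, b, hb, hab⟩ := Finset.one_lt_card.1 h1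
  refine le_trans ?_ (aux_le_fdiam ha hb)
  have : (1 : ℤ) ≤ |a - b| := Int.one_le_abs (sub_ne_zero.2 hab)
  exact_mod_cast this

lemma aux_sep_mono {M : ℝ} (hM : 1 < M) {A B A' B' : Finset ℤ} (hA : A' ⊆ A) (hB : B' ⊆ B)
    (hA' : A'.Nonempty) (hB' : B'.Nonempty)
    (h : M * min (fdiam A) (fdiam B) ^ ((3 : ℝ) / 2) < fdist A B) :
    M * min (fdiam A') (fdiam B') ^ ((3 : ℝ) / 2) < fdist A' B' := by
  have h1 : fdist A B ≤ fdist A' B' := by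
    obtain ⟨a, ha, b, hb, e⟩ := aux_fdist_eq hA' hB'
    rw [e]
    exact aux_fdist_le (hA ha) (hB hb)
  have mono : ∀ {X Y : Finset ℤ}, X ⊆ Y → X.Nonempty → 0 ≤ fdiam X ∧ fdiam X ≤ fdiam Y := by
    intro X Y hXY hX
    obtain ⟨a, ha, b, hb, e⟩ := aux_fdiam_eq hX
    rw [e]
    exact ⟨abs_nonneg _, aux_le_fdiam (hXY ha) (hXY hb)⟩
  have h2 := mono hA hA'
  have h3 := mono hB hB'
  refine lt_of_le_of_lt ?_ (lt_of_lt_of_le h h1)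
  apply mul_le_mul_of_nonneg_left _ (by linarith)
  exact Real.rpow_le_rpow (le_min h2.1 h3.1) (min_le_min h2.2 h3.2) (by norm_num)

/-- Even partitions whose parts are pairwise far apart. -/
def AuxGood (M : ℝ) (P : Finset (Finset ℤ)) (σ : Finset ℤ) : Prop :=
  IsEvenPartition P σ ∧ ∀ A ∈ P, ∀ B ∈ P, A ≠ B →
    M * min (fdiam A) (fdiam B) ^ ((3 : ℝ) / 2) < fdist A B

lemma aux_good_of {M : ℝ} {P : Finset (Finset ℤ)} {σ : Finset ℤ} (h : IsMPartitionOf M P σ) :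
    AuxGood M P σ :=
  ⟨⟨fun p hp => ⟨(h.1 p hp).1, (h.1 p hp).2.1⟩, h.2.1, h.2.2.1⟩,
    fun A hA B hB hAB => (h.2.2.2 A hA B hB hAB).2⟩

/-- Two parts meeting a common set `A` cannot both have diameter at least that of `A`. -/
lemma aux_small {M : ℝ} (hM : 1 < M) {Q : Finset (Finset ℤ)} {σ A B B' : Finset ℤ}
    (hQ : AuxGood M Q σ) (hA : A.Nonempty) (hAe : Even A.card) (hB : B ∈ Q) (hB' : B' ∈ Q)
    (hne : B' ≠ B) (h1 : (A ∩ B).Nonempty) (h2 : (A ∩ B').Nonempty) (hd : fdiam A ≤ fdiam B) :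
    fdiam B' < fdiam A := by
  by_contra hcon
  push Not at hcon
  obtain ⟨x, hx⟩ := h1
  obtain ⟨y, hy⟩ := h2
  rw [Finset.mem_inter] at hx hy
  have h3 := hQ.2 B' hB' B hB hne
  have h4 : fdist B' B ≤ fdiam A :=
    (aux_fdist_le hy.2 hx.2).trans (aux_le_fdiam hy.1 hx.1)
  have h5 := aux_one_le_fdiam hA hAe
  have h6 : fdiam A ≤ min (fdiam B') (fdiam B) := le_min hcon hd
  have h7 : min (fdiam B') (fdiam B) ≤ min (fdiam B') (fdiam B) ^ ((3 : ℝ) / 2) :=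
    Real.self_le_rpow_of_one_le (h5.trans h6) (by norm_num)
  nlinarith

lemma aux_card_sum {M : ℝ} {Q : Finset (Finset ℤ)} {σ A : Finset ℤ} (hQ : AuxGood M Q σ)
    (hA : A ⊆ σ) : A.card = ∑ B ∈ Q, (A ∩ B).card := by
  rw [← Finset.card_biUnion]
  · congr 1
    ext x
    simp only [Finset.mem_biUnion, Finset.mem_inter]
    constructor
    · intro hx
      have := hA hx
      rw [← hQ.1.2.2] at this
      obtain ⟨B, hB, hxB⟩ := Finset.mem_biUnion.1 this
      exact ⟨B, hB, hx, hxB⟩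
    · rintro ⟨B, -, hx, -⟩
      exact hx
  · intro B hB B' hB' hne
    exact Finset.disjoint_of_subset_left Finset.inter_subset_right
      (Finset.disjoint_of_subset_right Finset.inter_subset_right (hQ.1.2.1 hB hB' hne))

lemma aux_subset {M : ℝ} {Q : Finset (Finset ℤ)} {σ A : Finset ℤ} (hQ : AuxGood M Q σ)
    (hA : A ∈ Q) : A ⊆ σ := by
  rw [← hQ.1.2.2]
  exact Finset.subset_biUnion_of_mem id hA

lemma aux_even {M : ℝ} (hM : 1 < M) {σ : Finset ℤ} (n : ℕ) :
    ∀ {P Q : Finset (Finset ℤ)}, AuxGood M P σ → AuxGood M Q σ → ∀ A ∈ P, ∀ B ∈ Q,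
      (A ∩ B).Nonempty → fdiam A = n → fdiam A ≤ fdiam B → Even (A ∩ B).card := by
  induction n using Nat.strong_induction_on with
  | _ n ih =>
    intro P Q hP hQ A hA B hB hAB hn hd
    obtain ⟨hAn, hAe⟩ := hP.1.1 A hA
    have hs := aux_card_sum hQ (aux_subset hP hA)
    rw [← Finset.add_sum_erase _ _ hB] at hs
    have he : Even (∑ B' ∈ Q.erase B, (A ∩ B').card) := by
      apply Finset.even_sum
      intro B' hB'
      rw [Finset.mem_erase] at hB'
      by_cases hne : (A ∩ B').Nonempty
      · have hlt := aux_small hM hQ hAn hAe hB hB'.2 hB'.1 hAB hne hd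
        obtain ⟨m, hm⟩ := aux_fdiam_nat (hQ.1.1 B' hB'.2).1
        have hmn : m < n := by
          rw [hm, hn] at hlt
          exact_mod_cast hlt
        have := ih m hmn hQ hP B' hB'.2 A hA (by rwa [Finset.inter_comm]) hm hlt.le
        rwa [Finset.inter_comm]
      · rw [Finset.not_nonempty_iff_eq_empty.1 hne]
        simp
    rw [hs] at hAe
    exact (Nat.even_add.1 hAe).2 he

lemma aux_even' {M : ℝ} (hM : 1 < M) {σ : Finset ℤ} {P Q : Finset (Finset ℤ)}
    (hP : AuxGood M P σ) (hQ : AuxGood M Q σ) {A B : Finset ℤ} (hA : A ∈ P) (hB : B ∈ Q)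
    (hAB : (A ∩ B).Nonempty) : Even (A ∩ B).card := by
  rcases le_total (fdiam A) (fdiam B) with h | h
  · obtain ⟨m, hm⟩ := aux_fdiam_nat (hP.1.1 A hA).1
    exact aux_even hM m hP hQ A hA B hB hAB hm h
  · obtain ⟨m, hm⟩ := aux_fdiam_nat (hQ.1.1 B hB).1
    rw [Finset.inter_comm] at hAB ⊢
    exact aux_even hM m hQ hP B hB A hA hAB hm h

/-- A contour of one M-partition is contained in a contour of any other. -/
lemma aux_le {M : ℝ} (hM : 1 < M) {σ : Finset ℤ} {P Q : Finset (Finset ℤ)}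
    (hP : IsMPartitionOf M P σ) (hQ : IsMPartitionOf M Q σ) {A : Finset ℤ} (hA : A ∈ P) :
    ∃ B ∈ Q, A ⊆ B := by
  have gP := aux_good_of hP
  have gQ := aux_good_of hQ
  have hAσ := aux_subset gP hA
  obtain ⟨hAn, hAe, hc⟩ := hP.1 A hA
  have key : ∀ x ∈ A, ∃ B ∈ Q, x ∈ B := by
    intro x hx
    have := hAσ hx
    rw [← gQ.1.2.2] at this
    simpa using this
  set R := (Q.filter fun B => (A ∩ B).Nonempty).image fun B => A ∩ B with hR
  have memR : ∀ p, p ∈ R ↔ ∃ B ∈ Q, (A ∩ B).Nonempty ∧ A ∩ B = p := by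
    intro p
    simp [hR, and_assoc]
  have hRe : IsEvenPartition R A := by
    refine ⟨?_, ?_, ?_⟩
    · intro p hp
      obtain ⟨B, hB, hn, rfl⟩ := (memR p).1 hp
      exact ⟨hn, aux_even' hM gP gQ hA hB hn⟩
    · intro p hp q hq hpq
      obtain ⟨B, hB, hn, rfl⟩ := (memR p).1 hp
      obtain ⟨B', hB', hn', rfl⟩ := (memR q).1 hq
      have hne : B ≠ B' := by
        rintro rfl
        exact hpq rfl
      exact Finset.disjoint_of_subset_left Finset.inter_subset_right
        (Finset.disjoint_of_subset_right Finset.inter_subset_right (gQ.1.2.1 hB hB' hne))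
    · ext x
      simp only [Finset.mem_biUnion, id]
      constructor
      · rintro ⟨p, hp, hx⟩
        obtain ⟨B, hB, hn, rfl⟩ := (memR p).1 hp
        exact (Finset.mem_inter.1 hx).1
      · intro hx
        obtain ⟨B, hB, hxB⟩ := key x hx
        have := Finset.mem_inter.2 ⟨hx, hxB⟩
        exact ⟨A ∩ B, (memR _).2 ⟨B, hB, ⟨x, this⟩, rfl⟩, this⟩
  have hcard : R.card ≤ 1 := by
    by_contra hcon
    obtain ⟨p, hp, q, hq, hpq, hle⟩ := hc R hRe (by omega)
    obtain ⟨B, hB, hn, rfl⟩ := (memR p).1 hp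
    obtain ⟨B', hB', hn', rfl⟩ := (memR q).1 hq
    have hne : B ≠ B' := by
      rintro rfl
      exact hpq rfl
    exact absurd hle (not_le.2 (aux_sep_mono hM Finset.inter_subset_right
      Finset.inter_subset_right hn hn' (gQ.2 B hB B' hB' hne)))
  obtain ⟨x, hx⟩ := hAn
  obtain ⟨B, hB, hxB⟩ := key x hx
  refine ⟨B, hB, fun y hy => ?_⟩
  obtain ⟨B', hB', hyB'⟩ := key y hy
  have e := Finset.card_le_one.1 hcard (A ∩ B)
    ((memR _).2 ⟨B, hB, ⟨x, Finset.mem_inter.2 ⟨hx, hxB⟩⟩, rfl⟩) (A ∩ B')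
    ((memR _).2 ⟨B', hB', ⟨y, Finset.mem_inter.2 ⟨hy, hyB'⟩⟩, rfl⟩)
  have : y ∈ A ∩ B := by
    rw [e]
    exact Finset.mem_inter.2 ⟨hy, hyB'⟩
  exact (Finset.mem_inter.1 this).2

lemma aux_sub {M : ℝ} (hM : 1 < M) {σ : Finset ℤ} {P Q : Finset (Finset ℤ)}
    (hP : IsMPartitionOf M P σ) (hQ : IsMPartitionOf M Q σ) : P ⊆ Q := by
  intro A hA
  obtain ⟨B, hB, hAB⟩ := aux_le hM hP hQ hA
  obtain ⟨C, hC, hBC⟩ := aux_le hM hQ hP hB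
  have hAC : A = C := by
    by_contra hne
    obtain ⟨x, hx⟩ := (hP.1 A hA).1
    exact Finset.disjoint_left.1 (hP.2.1 hA hC hne) hx (hBC (hAB hx))
  subst hAC
  rwa [Finset.Subset.antisymm hAB hBC]

lemma aux_refine {M : ℝ} (hM : 1 < M) {σ p : Finset ℤ} {P Q : Finset (Finset ℤ)}
    (hP : AuxGood M P σ) (hp : p ∈ P) (hQ : AuxGood M Q p) : AuxGood M (P.erase p ∪ Q) σ := by
  have hsub : ∀ q ∈ Q, q ⊆ p := fun q hq => aux_subset hQ hq
  refine ⟨⟨?_, ?_, ?_⟩, ?_⟩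
  · intro q hq
    rcases Finset.mem_union.1 hq with h | h
    · exact hP.1.1 q (Finset.mem_of_mem_erase h)
    · exact hQ.1.1 q h
  · intro a ha b hb hab
    rcases Finset.mem_union.1 ha with h | h <;> rcases Finset.mem_union.1 hb with h' | h'
    · exact hP.1.2.1 (Finset.mem_of_mem_erase h) (Finset.mem_of_mem_erase h') hab
    · exact Finset.disjoint_of_subset_right (hsub b h')
        (hP.1.2.1 (Finset.mem_of_mem_erase h) hp (Finset.ne_of_mem_erase h))
    · exact Finset.disjoint_of_subset_left (hsub a h)
        (hP.1.2.1 hp (Finset.mem_of_mem_erase h') (Finset.ne_of_mem_erase h').symm)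
    · exact hQ.1.2.1 h h' hab
  · rw [Finset.union_biUnion, hQ.1.2.2, ← hP.1.2.2]
    conv_rhs => rw [← Finset.insert_erase hp, Finset.biUnion_insert, Finset.union_comm]
    rfl
  · intro a ha b hb hab
    rcases Finset.mem_union.1 ha with h | h <;> rcases Finset.mem_union.1 hb with h' | h'
    · exact hP.2 a (Finset.mem_of_mem_erase h) b (Finset.mem_of_mem_erase h') hab
    · exact aux_sep_mono hM subset_rfl (hsub b h') (hP.1.1 a (Finset.mem_of_mem_erase h)).1
        (hQ.1.1 b h').1 (hP.2 a (Finset.mem_of_mem_erase h) p hp (Finset.ne_of_mem_erase h))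
    · exact aux_sep_mono hM (hsub a h) subset_rfl (hQ.1.1 a h).1
        (hP.1.1 b (Finset.mem_of_mem_erase h')).1
        (hP.2 p hp b (Finset.mem_of_mem_erase h') (Finset.ne_of_mem_erase h').symm)
    · exact hQ.2 a h b h' hab

lemma aux_exists {M : ℝ} (hM : 1 < M) {σ : Finset ℤ} (hσ : σ.Nonempty) (hσe : Even σ.card) :
    ∃ P, IsMPartitionOf M P σ := by
  have memS : ∀ P, P ∈ (σ.powerset.powerset.filter fun P => AuxGood M P σ) ↔ AuxGood M P σ := by
    intro P
    rw [Finset.mem_filter]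
    refine ⟨fun h => h.2, fun h => ⟨?_, h⟩⟩
    rw [Finset.mem_powerset]
    intro A hA
    exact Finset.mem_powerset.2 (aux_subset h hA)
  have h0 : AuxGood M {σ} σ := by
    refine ⟨⟨?_, ?_, ?_⟩, ?_⟩
    · intro p hp
      rw [Finset.mem_singleton.1 hp]
      exact ⟨hσ, hσe⟩
    · simp
    · simp
    · intro A hA B hB hAB
      exact absurd ((Finset.mem_singleton.1 hA).trans (Finset.mem_singleton.1 hB).symm) hAB
  obtain ⟨P, hPS, hmax⟩ := Finset.exists_max_image
    (σ.powerset.powerset.filter fun P => AuxGood M P σ) Finset.card ⟨{σ}, (memS _).2 h0⟩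
  have hP := (memS P).1 hPS
  refine ⟨P, ?_, hP.1.2.1, hP.1.2.2, fun A hA B hB hAB => ⟨hAB, hP.2 A hA B hB hAB⟩⟩
  intro p hp
  refine ⟨(hP.1.1 p hp).1, (hP.1.1 p hp).2, ?_⟩
  intro Q hQ hcard
  by_contra hcon
  push Not at hcon
  have gQ : AuxGood M Q p := ⟨hQ, hcon⟩
  have hle := hmax _ ((memS _).2 (aux_refine hM hP hp gQ))
  have hdisj : Disjoint (P.erase p) Q := by
    rw [Finset.disjoint_left]
    intro q hq hq'
    obtain ⟨x, hx⟩ := (hQ.1 q hq').1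
    exact Finset.disjoint_left.1
      (hP.1.2.1 (Finset.mem_of_mem_erase hq) hp (Finset.ne_of_mem_erase hq)) hx
      (aux_subset gQ hq' hx)
  rw [Finset.card_union_of_disjoint hdisj, Finset.card_erase_of_mem hp] at hle
  have := Finset.card_pos.2 ⟨p, hp⟩
  omega

/-- **Lemma (existence and uniqueness of the M-partition).**  For every `M > 1`,
every nonempty `σ* ∈ Ω*` (a finite set of spin flips of even cardinality) admits
exactly one `M`-partition. -/
theorem unique_M_partition (M : ℝ) (hM : 1 < M) (σ : Finset ℤ)
    (hσ : σ.Nonempty) (hσe : Even σ.card) :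
    ∃! Γ : Finset (Finset ℤ), IsMPartitionOf M Γ σ := by
  obtain ⟨P, hP⟩ := aux_exists hM hσ hσe
  exact ⟨P, hP, fun Q hQ => Finset.Subset.antisymm (aux_sub hM hQ hP) (aux_sub hM hP hQ)⟩

end
end

section
/- Let m, n ∈ ℕ with 2 ≤ m ≤ n, and let T be a tree with vertex set {1,…,n} such that every leaf of T belongs to {1,…,m} and every vertex in {m+1,…,n} has degree at least 3 in T. Then n ≤ 2m − 2. -/
open scoped Classical

/-- **Lemma (tree size).**  Let `2 ≤ m ≤ n` and let `T` be a tree on `{1,…,n}` whose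
leaves all lie in `{1,…,m}` and whose vertices outside `{1,…,m}` all have degree at
least `3`.  Then `n ≤ 2m − 2`. -/
theorem tree_size (m n : ℕ) (hm : 2 ≤ m) (hmn : m ≤ n)
    (T : SimpleGraph (Fin n)) (hT : T.IsTree)
    (hleaf : ∀ x : Fin n, T.degree x = 1 → (x : ℕ) < m)
    (hdeg : ∀ x : Fin n, m ≤ (x : ℕ) → 3 ≤ T.degree x) :
    n ≤ 2 * m - 2 := by
  obtain ⟨k, rfl⟩ := Nat.exists_eq_add_of_le hmn
  haveI : Nontrivial (Fin (m + k)) := Fin.nontrivial_iff_two_le.mpr (by omega)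
  have hE := hT.card_edgeFinset
  have hS := T.sum_degrees_eq_twice_card_edges
  rw [Fin.sum_univ_add] at hS
  have h1 : ∑ _i : Fin m, 1 ≤ ∑ i : Fin m, T.degree (Fin.castAdd k i) :=
    Finset.sum_le_sum fun i _ => hT.connected.preconnected.degree_pos_of_nontrivial _
  have h2 : ∑ _i : Fin k, 3 ≤ ∑ i : Fin k, T.degree (Fin.natAdd m i) :=
    Finset.sum_le_sum fun i _ => hdeg _ (by simp)
  simp only [Finset.sum_const, Finset.card_univ, Fintype.card_fin, smul_eq_mul] at h1 h2 hE
  omega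
end

section
/- Assume there is a constant c₀ > 0 with diam(γ) ≤ e^{c₀H(γ)} for every γ ∈ 𝒞, and assume Hypothesis (H3) with constants β₀′, c₂ > 0. Then there exists β₀ > 0 such that for every β ≥ β₀ and every γ₁ ∈ 𝒞, Σ_{γ∈𝒞 : γ positively compatible with γ₁} e^{−βH(γ)}·Φ(γ,γ₁) ≤ 2·e^{−c₂β/2}·H(γ₁). -/
open scoped Classical BigOperators ENNReal

noncomputable section

/-- Translation of a set of dual sites. -/
def shiftF (a : ℤ) (γ : Finset ℤ) : Finset ℤ := γ.image (fun b => b + a)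

lemma shiftF_mem (a : ℤ) (γ : Finset ℤ) (b : ℤ) : b ∈ shiftF a γ ↔ b - a ∈ γ := by
  unfold shiftF
  rw [Finset.mem_image]
  constructor
  · rintro ⟨c, hc, rfl⟩; simpa using hc
  · intro h; exact ⟨_, h, by ring⟩

lemma shiftF_shiftF (a : ℤ) (γ : Finset ℤ) : shiftF a (shiftF (-a) γ) = γ := by
  ext b; simp [shiftF_mem]

lemma shiftF_inj (a : ℤ) : Function.Injective (shiftF a) := by
  intro s t h
  have := congrArg (shiftF (-a)) h
  have e := shiftF_shiftF (-a)
  rw [neg_neg] at e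
  rwa [e, e] at this

lemma shiftF_card (a : ℤ) (γ : Finset ℤ) : (shiftF a γ).card = γ.card :=
  Finset.card_image_of_injective _ (add_left_injective a)

lemma shiftF_image (a : ℤ) (s t : Finset ℤ) :
    ((shiftF a s ×ˢ shiftF a t).image fun p : ℤ × ℤ => |(p.1 : ℝ) - (p.2 : ℝ)|) =
    (s ×ˢ t).image fun p : ℤ × ℤ => |(p.1 : ℝ) - (p.2 : ℝ)| := by
  ext r
  simp only [Finset.mem_image, Finset.mem_product, shiftF_mem, Prod.exists]
  constructor
  · rintro ⟨x, y, h, rfl⟩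
    exact ⟨x - a, y - a, h, by push_cast; congr 1; ring⟩
  · rintro ⟨x, y, h, rfl⟩
    exact ⟨x + a, y + a, by simpa using h, by push_cast; congr 1; ring⟩

lemma shiftF_nonempty (a : ℤ) (s : Finset ℤ) : (shiftF a s).Nonempty ↔ s.Nonempty := by
  unfold shiftF; exact Finset.image_nonempty

lemma fdist_shiftF (a : ℤ) (s t : Finset ℤ) : fdist (shiftF a s) (shiftF a t) = fdist s t := by
  unfold fdist
  simp only [shiftF_image, Finset.nonempty_product, shiftF_nonempty]

lemma fdiam_shiftF (a : ℤ) (s : Finset ℤ) : fdiam (shiftF a s) = fdiam s := by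
  unfold fdiam
  simp only [shiftF_image, Finset.nonempty_product, shiftF_nonempty]

lemma isContour_shiftF (M : ℝ) (a : ℤ) (γ : Finset ℤ) (h : IsContour M γ) :
    IsContour M (shiftF a γ) := by
  obtain ⟨h1, h2, h3⟩ := h
  refine ⟨(shiftF_nonempty _ _).2 h1, by rwa [shiftF_card], ?_⟩
  intro P hP hc
  obtain ⟨p1, p2, p3⟩ := hP
  have hQ : IsEvenPartition (P.image (shiftF (-a))) γ := by
    refine ⟨?_, ?_, ?_⟩
    · intro p hp
      obtain ⟨q, hq, rfl⟩ := Finset.mem_image.1 hp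
      rw [shiftF_nonempty, shiftF_card]
      exact p1 q hq
    · intro s hs t ht hst
      obtain ⟨q, hq, rfl⟩ := Finset.mem_image.1 (Finset.mem_coe.1 hs)
      obtain ⟨r, hr, rfl⟩ := Finset.mem_image.1 (Finset.mem_coe.1 ht)
      have hd : Disjoint q r := p2 (Finset.mem_coe.2 hq) (Finset.mem_coe.2 hr)
        (fun e => hst (by rw [e]))
      show Disjoint (shiftF (-a) q) (shiftF (-a) r)
      rw [Finset.disjoint_left] at hd ⊢
      intro b hb hb'
      rw [shiftF_mem] at hb hb'
      exact hd hb hb'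
    · ext b
      have := congrArg (fun s => b + a ∈ s) p3
      simp only [Finset.mem_biUnion, id, shiftF_mem, add_sub_cancel_right, eq_iff_iff] at this
      rw [← this]
      simp only [Finset.mem_biUnion, id, Finset.mem_image]
      constructor
      · rintro ⟨s, ⟨q, hq, rfl⟩, hb⟩
        rw [shiftF_mem] at hb
        exact ⟨q, hq, by simpa using hb⟩
      · rintro ⟨q, hq, hb⟩
        exact ⟨_, ⟨q, hq, rfl⟩, by rw [shiftF_mem]; simpa using hb⟩
  obtain ⟨s, hs, t, ht, hst, hd⟩ := h3 _ hQ
    (by rwa [Finset.card_image_of_injective _ (shiftF_inj _)])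
  obtain ⟨q, hq, rfl⟩ := Finset.mem_image.1 hs
  obtain ⟨r, hr, rfl⟩ := Finset.mem_image.1 ht
  rw [fdist_shiftF, fdiam_shiftF, fdiam_shiftF] at hd
  exact ⟨q, hq, r, hr, fun e => hst (by rw [e]), hd⟩

lemma minusI_shiftF (a : ℤ) (γ : Finset ℤ) (x : ℤ) :
    x ∈ minusI (shiftF a γ) ↔ x - a ∈ minusI γ := by
  unfold minusI
  simp only [Set.mem_setOf_eq]
  have : (shiftF a γ).filter (fun b => x ≤ b) = shiftF a (γ.filter fun b => x - a ≤ b) := by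
    ext b
    simp [shiftF_mem]
  rw [this, shiftF_card]

lemma J_shift (α : ℝ) (a x y : ℤ) : J α (x + a) (y + a) = J α x y := by
  unfold J
  simp

lemma Hcont_shiftF (α : ℝ) (a : ℤ) (γ : Finset ℤ) : Hcont α (shiftF a γ) = Hcont α γ := by
  unfold Hcont HamSet
  rw [← ((Equiv.addRight a).prodCongr (Equiv.addRight a)).tsum_eq
    (fun p : ℤ × ℤ => if p.1 ∈ minusI (shiftF a γ) ∧ p.2 ∉ minusI (shiftF a γ)
      then 2 * J α p.1 p.2 else 0)]
  apply tsum_congr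
  intro p
  simp only [Equiv.prodCongr_apply, Prod.map_fst, Prod.map_snd, Equiv.coe_addRight,
    minusI_shiftF, add_sub_cancel_right, J_shift]

lemma minusI_finite (γ : Finset ℤ) (h : Even γ.card) : (minusI γ).Finite := by
  by_cases hne : γ.Nonempty
  · apply (Set.finite_Icc (γ.min' hne) (γ.max' hne)).subset
    intro x hx
    have hx' : Odd (γ.filter fun b => x ≤ b).card := hx
    constructor
    · by_contra hlt
      rw [not_le] at hlt
      rw [Finset.filter_true_of_mem] at hx'
      · exact (Nat.not_even_iff_odd.2 hx') h
      · intro b hb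
        exact hlt.le.trans (γ.min'_le b hb)
    · by_contra hlt
      rw [not_le] at hlt
      rw [Finset.filter_false_of_mem] at hx'
      · simp at hx'
      · intro b hb
        exact not_le.2 ((γ.le_max' b hb).trans_lt hlt)
  · rw [Finset.not_nonempty_iff_eq_empty] at hne
    subst hne
    simp [minusI]

lemma J_nonneg (α : ℝ) (x y : ℤ) : 0 ≤ J α x y := by
  unfold J
  split_ifs
  · exact le_rfl
  · positivity

lemma J_summable (α : ℝ) (hα : 1 < α) (x : ℤ) : Summable fun y => J α x y := by
  have h := Real.summable_abs_int_rpow hα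
  have h2 := (Equiv.subRight x).summable_iff.2 h
  refine Summable.of_nonneg_of_le (fun y => J_nonneg α x y) ?_ h2
  intro y
  simp only [Function.comp, Equiv.subRight_apply]
  unfold J
  split_ifs
  · positivity
  · push_cast
    rw [abs_sub_comm]

lemma ham_summable (α : ℝ) (hα : 1 < α) (A : Set ℤ) (hA : A.Finite) :
    Summable fun p : ℤ × ℤ => if p.1 ∈ A ∧ p.2 ∉ A then 2 * J α p.1 p.2 else 0 := by
  rw [summable_prod_of_nonneg]
  · constructor
    · intro x
      refine Summable.of_nonneg_of_le ?_ ?_ ((J_summable α hα x).mul_left 2)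
      · intro y
        have := J_nonneg α x y
        dsimp only
        split_ifs <;> linarith
      · intro y
        have := J_nonneg α x y
        dsimp only
        split_ifs <;> linarith
    · apply summable_of_hasFiniteSupport
      apply hA.subset
      intro x hx
      by_contra hxA
      exact hx (by simp [hxA])
  · intro p
    have := J_nonneg α p.1 p.2
    dsimp only [Pi.zero_apply]
    split_ifs <;> linarith

lemma ofReal_tsum_le' {ι : Type*} (f : ι → ℝ) (hf : ∀ i, 0 ≤ f i) :
    ENNReal.ofReal (∑' i, f i) ≤ ∑' i, ENNReal.ofReal (f i) := by
  by_cases h : Summable f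
  · exact (ENNReal.ofReal_tsum_of_nonneg hf h).le
  · simp [tsum_eq_zero_of_not_summable h]

/-- Translated form of (H3). -/
lemma h3_at (α M : ℝ) (β : ℝ) (C : ℝ≥0∞)
    (h3 : (∑' γ : {γ : Finset ℤ // IsContour M γ ∧ (0 : ℤ) ∈ minusI γ},
        ENNReal.ofReal (Real.exp (-β * Hcont α γ.1))) ≤ C) (x : ℤ) :
    (∑' γ : Finset ℤ, if IsContour M γ ∧ x ∈ minusI γ then
      ENNReal.ofReal (Real.exp (-β * Hcont α γ)) else 0) ≤ C := by
  refine le_trans ?_ h3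
  have e1 := tsum_subtype {γ : Finset ℤ | IsContour M γ ∧ x ∈ minusI γ}
    (fun γ => ENNReal.ofReal (Real.exp (-β * Hcont α γ)))
  have e2 : (∑' γ : Finset ℤ, if IsContour M γ ∧ x ∈ minusI γ then
      ENNReal.ofReal (Real.exp (-β * Hcont α γ)) else 0) =
      ∑' γ : {γ : Finset ℤ | IsContour M γ ∧ x ∈ minusI γ},
        ENNReal.ofReal (Real.exp (-β * Hcont α γ.1)) := by
    rw [e1]
    apply tsum_congr
    intro γ
    simp only [Set.indicator_apply, Set.mem_setOf_eq]
  rw [e2]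
  let φ : {γ : Finset ℤ | IsContour M γ ∧ x ∈ minusI γ} →
      {γ : Finset ℤ // IsContour M γ ∧ (0 : ℤ) ∈ minusI γ} := fun γ =>
    ⟨shiftF (-x) γ.1, isContour_shiftF M _ _ γ.2.1, by
      rw [minusI_shiftF]; simpa using γ.2.2⟩
  have hφ : Function.Injective φ := by
    intro s t h
    exact Subtype.ext (shiftF_inj (-x) (congrArg Subtype.val h))
  refine le_trans (le_of_eq ?_) (ENNReal.tsum_comp_le_tsum_of_injective hφ _)
  apply tsum_congr
  intro γ
  show _ = ENNReal.ofReal (Real.exp (-β * Hcont α (shiftF (-x) γ.1)))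
  rw [Hcont_shiftF]

/-- **Lemma (leaf pruning for contours).**  Assume `diam γ ≤ e^{c₀ H(γ)}` for all
contours and Hypothesis (H3).  Then for `β` large and every contour `γ₁`,
`Σ_{γ ∼⁺ γ₁} e^{-βH(γ)} Φ(γ,γ₁) ≤ 2 e^{-c₂β/2} H(γ₁)`. -/
theorem contour_leaf_pruning (α M : ℝ) (hα : 1 < α ∧ α ≤ 2) (hM : 1 < M)
    (c₀ : ℝ) (hc₀ : 0 < c₀)
    (hdiam : ∀ γ, IsContour M γ → fdiam γ ≤ Real.exp (c₀ * Hcont α γ))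
    (β₀' c₂ : ℝ) (hβ₀' : 0 < β₀') (hc₂ : 0 < c₂)
    (h3 : ∀ β ≥ β₀',
      (∑' γ : {γ : Finset ℤ // IsContour M γ ∧ (0 : ℤ) ∈ minusI γ},
        ENNReal.ofReal (Real.exp (-β * Hcont α γ.1))) ≤
      ENNReal.ofReal (Real.exp (-c₂ * β))) :
    ∃ β₀ > (0 : ℝ), ∀ β ≥ β₀, ∀ γ₁ : Finset ℤ, IsContour M γ₁ →
      (∑' γ : {γ : Finset ℤ // IsContour M γ ∧ PosCompat M γ γ₁},
        ENNReal.ofReal (Real.exp (-β * Hcont α γ.1) *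
          PhiSet α (minusI γ.1) (minusI γ₁))) ≤
      ENNReal.ofReal (2 * Real.exp (-c₂ * β / 2) * Hcont α γ₁) := by
  refine ⟨β₀', hβ₀', fun β hβ γ₁ hγ₁ => ?_⟩
  have hβ0 : 0 < β := lt_of_lt_of_le hβ₀' hβ
  have key := h3_at α M β _ (h3 β hβ)
  set w : Finset ℤ → ℝ≥0∞ := fun γ => ENNReal.ofReal (Real.exp (-β * Hcont α γ)) with hw
  set A := minusI γ₁ with hA
  have hfin : A.Finite := minusI_finite γ₁ hγ₁.2.1
  have hJ := J_nonneg α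
  have hHnn : 0 ≤ Hcont α γ₁ := by
    unfold Hcont HamSet
    apply tsum_nonneg
    intro p
    have := hJ p.1 p.2
    split_ifs <;> linarith
  calc (∑' γ : {γ : Finset ℤ // IsContour M γ ∧ PosCompat M γ γ₁},
        ENNReal.ofReal (Real.exp (-β * Hcont α γ.1) * PhiSet α (minusI γ.1) A))
      ≤ ∑' γ : {γ : Finset ℤ // IsContour M γ ∧ PosCompat M γ γ₁}, ∑' p : ℤ × ℤ,
          w γ.1 * ENNReal.ofReal (if p.1 ∈ A ∧ p.2 ∈ minusI γ.1 then 4 * J α p.1 p.2 else 0) := by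
        apply ENNReal.tsum_le_tsum
        intro γ
        rw [ENNReal.ofReal_mul (Real.exp_pos _).le, ENNReal.tsum_mul_left, PhiSet_symm]
        apply mul_le_mul_right
        apply ofReal_tsum_le'
        intro p
        have := hJ p.1 p.2
        split_ifs <;> linarith
    _ = ∑' p : ℤ × ℤ, ∑' γ : {γ : Finset ℤ // IsContour M γ ∧ PosCompat M γ γ₁},
          w γ.1 * ENNReal.ofReal (if p.1 ∈ A ∧ p.2 ∈ minusI γ.1 then 4 * J α p.1 p.2 else 0) :=
        ENNReal.tsum_comm
    _ ≤ ∑' p : ℤ × ℤ, ENNReal.ofReal (2 * Real.exp (-c₂ * β)) *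
          ENNReal.ofReal (if p.1 ∈ A ∧ p.2 ∉ A then 2 * J α p.1 p.2 else 0) := by
        apply ENNReal.tsum_le_tsum
        intro p
        by_cases hp : p.1 ∈ A ∧ p.2 ∉ A
        · rw [if_pos hp]
          calc (∑' γ : {γ : Finset ℤ // IsContour M γ ∧ PosCompat M γ γ₁}, w γ.1 *
                ENNReal.ofReal (if p.1 ∈ A ∧ p.2 ∈ minusI γ.1 then 4 * J α p.1 p.2 else 0))
              = ∑' γ : {γ : Finset ℤ // IsContour M γ ∧ PosCompat M γ γ₁},
                (if IsContour M γ.1 ∧ p.2 ∈ minusI γ.1 then w γ.1 else 0) *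
                  ENNReal.ofReal (4 * J α p.1 p.2) := by
                apply tsum_congr
                intro γ
                by_cases hq : p.2 ∈ minusI γ.1
                · rw [if_pos ⟨hp.1, hq⟩, if_pos ⟨γ.2.1, hq⟩]
                · rw [if_neg (fun h => hq h.2), if_neg (fun h => hq h.2)]
                  simp
            _ ≤ ENNReal.ofReal (Real.exp (-c₂ * β)) * ENNReal.ofReal (4 * J α p.1 p.2) := by
                rw [ENNReal.tsum_mul_right]
                apply mul_le_mul_left
                exact (ENNReal.tsum_comp_le_tsum_of_injective Subtype.val_injective
                  (fun γ : Finset ℤ =>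
                    if IsContour M γ ∧ p.2 ∈ minusI γ then w γ else 0)).trans (key p.2)
            _ = _ := by
                rw [← ENNReal.ofReal_mul (by positivity), ← ENNReal.ofReal_mul (by positivity)]
                congr 1
                ring
        · refine le_trans (le_of_eq ?_) (zero_le)
          rw [ENNReal.tsum_eq_zero]
          intro γ
          rw [if_neg]
          · simp
          · rintro ⟨ha, hb⟩
            apply hp
            exact ⟨ha, fun hc => (Set.disjoint_left.1 γ.2.2.2) hb hc⟩
    _ = ENNReal.ofReal (2 * Real.exp (-c₂ * β) * Hcont α γ₁) := by
        rw [ENNReal.tsum_mul_left, ← ENNReal.ofReal_tsum_of_nonneg _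
          (ham_summable α hα.1 A hfin), ← ENNReal.ofReal_mul (by positivity)]
        · rfl
        · intro p
          have := hJ p.1 p.2
          split_ifs <;> linarith
    _ ≤ _ := by
        apply ENNReal.ofReal_le_ofReal
        apply mul_le_mul_of_nonneg_right _ hHnn
        have : Real.exp (-c₂ * β) ≤ Real.exp (-c₂ * β / 2) := by
          apply Real.exp_le_exp.2
          nlinarith [mul_pos hc₂ hβ0]
        linarith

end
end
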